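/- arXiv:1204.5276 — 3 statements merged into one kernel-verified Lean document; each statement's English description precedes it below -/
import Mathlib

section
/- Let n be odd and let X = (X_{ij}) be the n×n matrix of indeterminates. Then the coefficient of the monomial ∏_{i=1}^n ∏_{j=1}^n X_{ij} in the polynomial Σ_{ρ,σ ∈ Sym(n)^n, ρ_1 = id} ε(σ_1) · (∏_{i=1}^n ε(σ_i)) · (∏_{j=1}^n ε(ρ_j)) · ∏_{i=1}^n ∏_{j=1}^n X_{σ_i(j), ρ_j(i)} (a polynomial over ℤ in n² variables) equals (−1)^{n(n−1)/2} · n! · ((n−1)!)² · AT(n) · (R_n^E − R_n^O). -/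
/-- `L` is a Latin square of order `n`: every row and every column is a
bijection of `Fin n` (i.e. contains each symbol exactly once). -/
def IsLatin {n : ℕ} (L : Fin n → Fin n → Fin n) : Prop :=
  (∀ i, Function.Bijective fun j => L i j) ∧ ∀ j, Function.Bijective fun i => L i j

/-- The permutation determined by a bijective function (junk value `1` otherwise). -/
noncomputable def permOf {n : ℕ} (f : Fin n → Fin n) : Equiv.Perm (Fin n) :=
  if h : Function.Bijective f then Equiv.ofBijective f h else 1

/-- The product of the signs of the rows of `L`. -/
noncomputable def rowSign {n : ℕ} (L : Fin n → Fin n → Fin n) : ℤ :=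
  ∏ i, (Equiv.Perm.sign (permOf fun j => L i j) : ℤ)

/-- The product of the signs of the columns of `L`. -/
noncomputable def colSign {n : ℕ} (L : Fin n → Fin n → Fin n) : ℤ :=
  ∏ j, (Equiv.Perm.sign (permOf fun i => L i j) : ℤ)

/-- The sign of a Latin square: row-sign times column-sign. -/
noncomputable def latinSign {n : ℕ} (L : Fin n → Fin n → Fin n) : ℤ :=
  rowSign L * colSign L

/-- The permutation `α_s` of a Latin square `L`: `α_s i = j` iff `L i j = s`. -/
noncomputable def symPerm {n : ℕ} (L : Fin n → Fin n → Fin n) (s : Fin n) :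
    Equiv.Perm (Fin n) :=
  permOf fun i => (permOf fun j => L i j).symm s

/-- The symbol-sign of a Latin square: the product of the signs of the `α_s`. -/
noncomputable def symbolSign {n : ℕ} (L : Fin n → Fin n → Fin n) : ℤ :=
  ∏ s, (Equiv.Perm.sign (symPerm L s) : ℤ)

/-- The number of Latin squares of order `n`. -/
noncomputable def numLatin (n : ℕ) : ℕ :=
  Nat.card {L : Fin n → Fin n → Fin n // IsLatin L}

/-- The number of even Latin squares of order `n`. -/
noncomputable def numLatinEven (n : ℕ) : ℕ :=
  Nat.card {L : Fin n → Fin n → Fin n // IsLatin L ∧ latinSign L = 1}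

/-- The number of odd Latin squares of order `n`. -/
noncomputable def numLatinOdd (n : ℕ) : ℕ :=
  Nat.card {L : Fin n → Fin n → Fin n // IsLatin L ∧ latinSign L = -1}

/-- `L` is normalized: its first row is the identity permutation. -/
def IsNormalized {n : ℕ} (L : Fin n → Fin n → Fin n) : Prop :=
  ∀ j : Fin n, L ⟨0, j.pos⟩ j = j

/-- `L` is unipotent: all entries on the main diagonal are equal. -/
def IsUnipotent {n : ℕ} (L : Fin n → Fin n → Fin n) : Prop :=
  ∀ i k : Fin n, L i i = L k k

/-- The Alon-Tarsi constant `AT(n) = U_n^E - U_n^O`. -/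
noncomputable def AT (n : ℕ) : ℤ :=
  (Nat.card {L : Fin n → Fin n → Fin n //
      IsLatin L ∧ IsNormalized L ∧ IsUnipotent L ∧ latinSign L = 1} : ℤ) -
  (Nat.card {L : Fin n → Fin n → Fin n //
      IsLatin L ∧ IsNormalized L ∧ IsUnipotent L ∧ latinSign L = -1} : ℤ)

/-- `L` is reduced: first row and first column are the identity. -/
def IsReducedLatin {n : ℕ} (L : Fin n → Fin n → Fin n) : Prop :=
  IsNormalized L ∧ ∀ i : Fin n, L i ⟨0, i.pos⟩ = i

/-- The number of even reduced Latin squares of order `n`. -/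
noncomputable def numReducedEven (n : ℕ) : ℕ :=
  Nat.card {L : Fin n → Fin n → Fin n // IsLatin L ∧ IsReducedLatin L ∧ latinSign L = 1}

/-- The number of odd reduced Latin squares of order `n`. -/
noncomputable def numReducedOdd (n : ℕ) : ℕ :=
  Nat.card {L : Fin n → Fin n → Fin n // IsLatin L ∧ IsReducedLatin L ∧ latinSign L = -1}

/-- `L_n^SE(π)`: Latin squares whose permutation `α₁` (of the first symbol)
is `π` and whose symbol-sign is `+1`. The first symbol is the element of
`Fin n` with value `0`, and `α₁ = π` is expressed by `L i (π i) = first symbol`. -/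
noncomputable def numSymEven (n : ℕ) (π : Equiv.Perm (Fin n)) : ℕ :=
  Nat.card {L : Fin n → Fin n → Fin n //
    IsLatin L ∧ (∀ i, (L i (π i)).val = 0) ∧ symbolSign L = 1}

/-- `L_n^SO(π)`: as `numSymEven` but with symbol-sign `-1`. -/
noncomputable def numSymOdd (n : ℕ) (π : Equiv.Perm (Fin n)) : ℕ :=
  Nat.card {L : Fin n → Fin n → Fin n //
    IsLatin L ∧ (∀ i, (L i (π i)).val = 0) ∧ symbolSign L = -1}

/-- `L_n^CE(π)`: column-even Latin squares with first column `π`. -/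
noncomputable def numColEven (n : ℕ) (π : Equiv.Perm (Fin n)) : ℕ :=
  Nat.card {L : Fin n → Fin n → Fin n //
    IsLatin L ∧ (∀ i : Fin n, L i ⟨0, i.pos⟩ = π i) ∧ colSign L = 1}

/-- `L_n^CO(π)`: column-odd Latin squares with first column `π`. -/
noncomputable def numColOdd (n : ℕ) (π : Equiv.Perm (Fin n)) : ℕ :=
  Nat.card {L : Fin n → Fin n → Fin n //
    IsLatin L ∧ (∀ i : Fin n, L i ⟨0, i.pos⟩ = π i) ∧ colSign L = -1}

/-- `L_n^CE(α, β)`: column-even Latin squares with first row `α` and first column `β`. -/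
noncomputable def numColEven₂ (n : ℕ) (α β : Equiv.Perm (Fin n)) : ℕ :=
  Nat.card {L : Fin n → Fin n → Fin n //
    IsLatin L ∧ (∀ j : Fin n, L ⟨0, j.pos⟩ j = α j) ∧
      (∀ i : Fin n, L i ⟨0, i.pos⟩ = β i) ∧ colSign L = 1}

/-- `L_n^CO(α, β)`: column-odd Latin squares with first row `α` and first column `β`. -/
noncomputable def numColOdd₂ (n : ℕ) (α β : Equiv.Perm (Fin n)) : ℕ :=
  Nat.card {L : Fin n → Fin n → Fin n //
    IsLatin L ∧ (∀ j : Fin n, L ⟨0, j.pos⟩ j = α j) ∧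
      (∀ i : Fin n, L i ⟨0, i.pos⟩ = β i) ∧ colSign L = -1}

/-- The `n × n` matrix of indeterminates, over `ℤ`. -/
noncomputable def Xmat (n : ℕ) :
    Matrix (Fin n) (Fin n) (MvPolynomial (Fin n × Fin n) ℤ) :=
  Matrix.of fun i j => MvPolynomial.X (i, j)

/-- The exponent vector of the square-free monomial `∏_{i,j} X i j`. -/
noncomputable def allOnes (n : ℕ) : (Fin n × Fin n) →₀ ℕ :=
  Finsupp.equivFunOnFinite.symm fun _ => 1

/-- The `(0,1)`-matrix (over `ℤ`) associated to a Boolean matrix. -/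
def toInt {n : ℕ} (A : Fin n → Fin n → Bool) : Matrix (Fin n) (Fin n) ℤ :=
  Matrix.of fun i j => if A i j then 1 else 0

/-- `σ₀(A)`: the number of zero entries of a `(0,1)`-matrix. -/
def sigma0 {n : ℕ} (A : Fin n → Fin n → Bool) : ℕ :=
  (Finset.univ.filter fun p : Fin n × Fin n => A p.1 p.2 = false).card

section PermOf

variable {n : ℕ}

theorem permOf_apply {f : Fin n → Fin n} (hf : Function.Bijective f) (x : Fin n) :
    permOf f x = f x := by
  rw [permOf, dif_pos hf]
  rfl

theorem permOf_coe (π : Equiv.Perm (Fin n)) : permOf (fun x => π x) = π := by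
  ext x
  rw [permOf_apply π.bijective]

theorem permOf_mul_right {f : Fin n → Fin n} (hf : Function.Bijective f)
    (τ : Equiv.Perm (Fin n)) : permOf (fun x => f (τ x)) = permOf f * τ := by
  ext x
  rw [permOf_apply (f := fun x => f (τ x)) (hf.comp τ.bijective),
    Equiv.Perm.mul_apply, permOf_apply hf]

theorem permOf_mul_left {f : Fin n → Fin n} (hf : Function.Bijective f)
    (τ : Equiv.Perm (Fin n)) : permOf (fun x => τ (f x)) = τ * permOf f := by
  ext x
  rw [permOf_apply (f := fun x => τ (f x)) (τ.bijective.comp hf),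
    Equiv.Perm.mul_apply, permOf_apply hf]

theorem permOf_eq_one_iff {f : Fin n → Fin n} (hf : Function.Bijective f) :
    permOf f = 1 ↔ ∀ x, f x = x := by
  simp [Equiv.ext_iff, permOf_apply hf]

end PermOf

section Counting

/-- If a subgroup `T` acts on `S` preserving `w`, and `φ` is an equivariant map from `S` to the
regular action of `T`, then all fibers of `φ` contribute equally to the sum of `w`. -/
theorem sum_eq_card_mul_sum_fiber {G α : Type*} [Group G] [Fintype G] [DecidableEq G]
    (a : G →* Equiv.Perm α) (T : Subgroup G) (S : Finset α) (φ : α → G) (w : α → ℤ)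
    (hφ : ∀ x ∈ S, φ x ∈ T) (hS : ∀ g ∈ T, ∀ x ∈ S, a g x ∈ S)
    (haφ : ∀ g ∈ T, ∀ x ∈ S, φ (a g x) = g * φ x)
    (hw : ∀ g ∈ T, ∀ x ∈ S, w (a g x) = w x) :
    ∑ x ∈ S, w x = Nat.card T * ∑ x ∈ S with φ x = 1, w x := by
  classical
  rw [← Finset.sum_fiberwise_of_maps_to (t := Finset.univ.filter (· ∈ T)) (g := φ)
    (fun x hx => by simpa using hφ x hx)]
  have key : ∀ g ∈ Finset.univ.filter (· ∈ T),
      ∑ x ∈ S with φ x = g, w x = ∑ x ∈ S with φ x = 1, w x := by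
    intro g hg
    have hg : g ∈ T := by simpa using hg
    have hg' := T.inv_mem hg
    refine Finset.sum_nbij' (a g⁻¹) (a g) ?_ ?_ ?_ ?_ ?_
    · intro x hx
      obtain ⟨hxS, hxg⟩ := Finset.mem_filter.1 hx
      exact Finset.mem_filter.2 ⟨hS _ hg' x hxS, by rw [haφ _ hg' x hxS, hxg, inv_mul_cancel]⟩
    · intro x hx
      obtain ⟨hx, h1⟩ := Finset.mem_filter.1 hx
      simp [hS _ hg x hx, haφ _ hg x hx, h1]
    · intro x _
      simp
    · intro x _
      simp
    · intro x hx
      exact (hw _ hg' x (Finset.mem_filter.1 hx).1).symm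
  rw [Finset.sum_congr rfl key, Finset.sum_const, nsmul_eq_mul, Nat.card_eq_fintype_card,
    Fintype.card_subtype]

theorem card_stabilizer_perm {n : ℕ} (z : Fin n) :
    Nat.card (MulAction.stabilizer (Equiv.Perm (Fin n)) z) = (n - 1).factorial := by
  classical
  have h := MulAction.card_orbit_mul_card_stabilizer_eq_card_group (Equiv.Perm (Fin n)) z
  have ho : Fintype.card (MulAction.orbit (Equiv.Perm (Fin n)) z) = n := by
    rw [← Nat.card_eq_fintype_card, MulAction.orbit_eq_univ]
    simp
  rw [ho, Fintype.card_perm, Fintype.card_fin, ← Nat.mul_factorial_pred z.pos.ne'] at h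
  rw [Nat.card_eq_fintype_card]
  exact Nat.eq_of_mul_eq_mul_left z.pos h

theorem sum_sign_eq_card_sub_card {α : Type*} [Fintype α] (P : α → Prop) [DecidablePred P]
    (w : α → ℤ)
    (hw : ∀ x, P x → w x = 1 ∨ w x = -1) :
    ∑ x with P x, w x =
      (Nat.card {x // P x ∧ w x = 1} : ℤ) - Nat.card {x // P x ∧ w x = -1} := by
  classical
  rw [Nat.card_eq_fintype_card, Nat.card_eq_fintype_card, Fintype.card_subtype,
    Fintype.card_subtype, Finset.card_filter, Finset.card_filter, Finset.sum_filter]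
  push_cast
  rw [← Finset.sum_sub_distrib]
  refine Finset.sum_congr rfl fun x _ => ?_
  by_cases hP : P x
  · rcases hw x hP with h | h <;> simp [hP, h]
  · simp [hP]

end Counting

section Signs

variable {n : ℕ}

theorem coe_sign_mul_self (τ : Equiv.Perm (Fin n)) :
    (Equiv.Perm.sign τ : ℤ) * Equiv.Perm.sign τ = 1 := by
  rw [← Units.val_mul, Int.units_mul_self, Units.val_one]

theorem latinSign_eq_one_or (L : Fin n → Fin n → Fin n) :
    latinSign L = 1 ∨ latinSign L = -1 := by
  have h : latinSign L = ((∏ i, Equiv.Perm.sign (permOf fun j => L i j)) *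
      ∏ j, Equiv.Perm.sign (permOf fun i => L i j) : ℤˣ) := by
    simp [latinSign, rowSign, colSign]
  rw [h]
  rcases Int.units_eq_one_or ((∏ i, Equiv.Perm.sign (permOf fun j => L i j)) *
      ∏ j, Equiv.Perm.sign (permOf fun i => L i j) : ℤˣ) with h | h <;> simp [h]

theorem rowSign_mul_self (L : Fin n → Fin n → Fin n) : rowSign L * rowSign L = 1 := by
  simp [rowSign, ← Finset.prod_mul_distrib]

theorem sign_prodComm_fin :
    Equiv.Perm.sign (Equiv.prodComm (Fin n) (Fin n)) = (-1) ^ (n * (n - 1) / 2) := by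
  rw [Equiv.Perm.sign_of_pow_two_eq_one (by ext x <;> simp [pow_two])]
  congr 2
  rw [Fintype.card_prod, Fintype.card_fin, Nat.mul_sub_one]
  congr 1
  have e : Function.fixedPoints (Equiv.prodComm (Fin n) (Fin n)) ≃ Fin n :=
    { toFun := fun p => p.1.1
      invFun := fun i => ⟨(i, i), rfl⟩
      left_inv := by
        rintro ⟨⟨i, j⟩, h⟩
        obtain rfl : j = i := congrArg Prod.fst h
        rfl
      right_inv := fun i => rfl }
  rw [Fintype.card_congr e, Fintype.card_fin]

theorem IsLatin.symPerm_bijective {L : Fin n → Fin n → Fin n} (hL : IsLatin L) (s : Fin n) :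
    Function.Bijective fun i => (permOf fun j => L i j).symm s := by
  refine Finite.injective_iff_bijective.1 fun i k h => ?_
  have h1 : L i ((permOf fun j => L i j).symm s) = s := by
    rw [← permOf_apply (hL.1 i), Equiv.apply_symm_apply]
  have h2 : L k ((permOf fun j => L k j).symm s) = s := by
    rw [← permOf_apply (hL.1 k), Equiv.apply_symm_apply]
  rw [← h] at h2
  exact (hL.2 _).1 (h1.trans h2.symm)

theorem IsLatin.apply_symPerm {L : Fin n → Fin n → Fin n} (hL : IsLatin L) (s i : Fin n) :
    L i (symPerm L s i) = s := by
  rw [symPerm, permOf_apply (hL.symPerm_bijective s), ← permOf_apply (hL.1 i),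
    Equiv.apply_symm_apply]

theorem IsLatin.symPerm_apply_eq_iff {L : Fin n → Fin n → Fin n} (hL : IsLatin L)
    (s i j : Fin n) : symPerm L s i = j ↔ L i j = s :=
  ⟨fun h => h ▸ hL.apply_symPerm s i,
    fun h => (hL.1 i).1 ((hL.apply_symPerm s i).trans h.symm)⟩

/-- The symbol-sign of a Latin square is determined by its row-sign and column-sign. -/
theorem IsLatin.symbolSign_eq {L : Fin n → Fin n → Fin n} (hL : IsLatin L) :
    symbolSign L = (-1) ^ (n * (n - 1) / 2) * latinSign L := by
  have h : Equiv.prodCongrRight (symPerm L) * Equiv.prodComm (Fin n) (Fin n) *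
      Equiv.prodCongrRight (fun r => permOf fun c => L r c) =
      (Equiv.prodCongrLeft (fun c => permOf fun r => L r c) :
        Equiv.Perm (Fin n × Fin n)) := by
    ext1 ⟨r, c⟩
    simp [permOf_apply (hL.1 _), permOf_apply (hL.2 _), hL.symPerm_apply_eq_iff]
  have h' := congrArg (fun π => (Equiv.Perm.sign π : ℤ)) h
  simp only [Equiv.Perm.sign_mul, Equiv.Perm.sign_prodCongrRight,
    Equiv.Perm.sign_prodCongrLeft, sign_prodComm_fin, Units.val_mul, Units.coe_prod] at h'
  change symbolSign L * _ * rowSign L = colSign L at h'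
  have hs : ((-1 : ℤ) ^ (n * (n - 1) / 2)) * (-1) ^ (n * (n - 1) / 2) = 1 := by
    rw [← mul_pow]; simp
  push_cast at h'
  rw [latinSign, ← h']
  linear_combination (-symbolSign L) * hs -
    symbolSign L * (-1) ^ (n * (n - 1) / 2) * (-1) ^ (n * (n - 1) / 2) * rowSign_mul_self L

end Signs

section Actions

variable {n : ℕ}

/-- Permutations acting on square arrays by permuting the columns. -/
def permuteColumns (n : ℕ) :
    Equiv.Perm (Fin n) →* Equiv.Perm (Fin n → Fin n → Fin n) where
  toFun τ :=
    { toFun := fun L i j => L i (τ⁻¹ j)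
      invFun := fun L i j => L i (τ j)
      left_inv := fun L => by simp
      right_inv := fun L => by simp }
  map_one' := rfl
  map_mul' τ₁ τ₂ := by ext; simp

/-- Permutations acting on square arrays by permuting the symbols. -/
def permuteSymbols (n : ℕ) :
    Equiv.Perm (Fin n) →* Equiv.Perm (Fin n → Fin n → Fin n) where
  toFun τ :=
    { toFun := fun L i j => τ (L i j)
      invFun := fun L i j => τ⁻¹ (L i j)
      left_inv := fun L => by simp
      right_inv := fun L => by simp }
  map_one' := rfl
  map_mul' τ₁ τ₂ := by ext; simp

theorem permuteColumns_apply (τ : Equiv.Perm (Fin n)) (L : Fin n → Fin n → Fin n)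
    (i j : Fin n) : permuteColumns n τ L i j = L i (τ⁻¹ j) := rfl

theorem permuteSymbols_apply (τ : Equiv.Perm (Fin n)) (L : Fin n → Fin n → Fin n)
    (i j : Fin n) : permuteSymbols n τ L i j = τ (L i j) := rfl

theorem IsLatin.permuteColumns {L : Fin n → Fin n → Fin n} (hL : IsLatin L)
    (τ : Equiv.Perm (Fin n)) : IsLatin (permuteColumns n τ L) :=
  ⟨fun i => (hL.1 i).comp (τ⁻¹).bijective, fun j => hL.2 (τ⁻¹ j)⟩

theorem IsLatin.permuteSymbols {L : Fin n → Fin n → Fin n} (hL : IsLatin L)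
    (τ : Equiv.Perm (Fin n)) : IsLatin (permuteSymbols n τ L) :=
  ⟨fun i => τ.bijective.comp (hL.1 i), fun j => τ.bijective.comp (hL.2 j)⟩

theorem IsLatin.permOf_row_permuteColumns {L : Fin n → Fin n → Fin n} (hL : IsLatin L)
    (τ : Equiv.Perm (Fin n)) (i : Fin n) :
    permOf (fun j => _root_.permuteColumns n τ L i j) = permOf (fun j => L i j) * τ⁻¹ :=
  permOf_mul_right (hL.1 i) τ⁻¹

theorem IsLatin.symPerm_permuteColumns {L : Fin n → Fin n → Fin n} (hL : IsLatin L)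
    (τ : Equiv.Perm (Fin n)) (s : Fin n) :
    symPerm (_root_.permuteColumns n τ L) s = τ * symPerm L s := by
  ext1 i
  rw [(hL.permuteColumns τ).symPerm_apply_eq_iff]
  simp [permuteColumns_apply, hL.apply_symPerm]

theorem sign_pow_of_odd (hn : Odd n) (τ : Equiv.Perm (Fin n)) :
    (Equiv.Perm.sign τ : ℤ) ^ n = Equiv.Perm.sign τ := by
  obtain ⟨k, rfl⟩ := hn
  rw [pow_succ, pow_mul, pow_two, coe_sign_mul_self, one_pow, one_mul]

theorem IsLatin.latinSign_permuteColumns {L : Fin n → Fin n → Fin n} (hL : IsLatin L)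
    (hn : Odd n) (τ : Equiv.Perm (Fin n)) :
    latinSign (_root_.permuteColumns n τ L) = latinSign L * Equiv.Perm.sign τ := by
  have hr : rowSign (_root_.permuteColumns n τ L) = rowSign L * Equiv.Perm.sign τ := by
    simp only [rowSign, hL.permOf_row_permuteColumns, Equiv.Perm.sign_mul,
      Equiv.Perm.sign_inv, Units.val_mul, Finset.prod_mul_distrib, Finset.prod_const,
      Finset.card_univ, Fintype.card_fin, sign_pow_of_odd hn]
  have hc : colSign (_root_.permuteColumns n τ L) = colSign L :=
    Equiv.prod_comp τ⁻¹ fun j => (Equiv.Perm.sign (permOf fun i => L i j) : ℤ)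
  rw [latinSign, hr, hc, latinSign]
  ring

theorem IsLatin.latinSign_permuteSymbols {L : Fin n → Fin n → Fin n} (hL : IsLatin L)
    (τ : Equiv.Perm (Fin n)) :
    latinSign (_root_.permuteSymbols n τ L) = latinSign L := by
  have hr : rowSign (_root_.permuteSymbols n τ L) =
      (Equiv.Perm.sign τ : ℤ) ^ n * rowSign L := by
    simp only [rowSign, permuteSymbols_apply, permOf_mul_left (hL.1 _), Equiv.Perm.sign_mul,
      Units.val_mul, Finset.prod_mul_distrib, Finset.prod_const, Finset.card_univ,
      Fintype.card_fin]
  have hc : colSign (_root_.permuteSymbols n τ L) =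
      (Equiv.Perm.sign τ : ℤ) ^ n * colSign L := by
    simp only [colSign, permuteSymbols_apply, permOf_mul_left (hL.2 _), Equiv.Perm.sign_mul,
      Units.val_mul, Finset.prod_mul_distrib, Finset.prod_const, Finset.card_univ,
      Fintype.card_fin]
  have hs : (Equiv.Perm.sign τ : ℤ) ^ n * (Equiv.Perm.sign τ : ℤ) ^ n = 1 := by
    rw [← mul_pow, coe_sign_mul_self, one_pow]
  rw [latinSign, hr, hc, latinSign]
  linear_combination rowSign L * colSign L * hs

end Actions

section LatinSums

variable {n : ℕ}

open scoped Classical in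
theorem sum_firstColumn_eq (hn : Odd n) :
    ∑ L : Fin n → Fin n → Fin n with IsLatin L ∧ ∀ i, L i ⟨0, hn.pos⟩ = i,
        latinSign L * Equiv.Perm.sign (permOf fun j => L ⟨0, hn.pos⟩ j) =
      (n - 1).factorial * ((numReducedEven n : ℤ) - numReducedOdd n) := by
  set z : Fin n := ⟨0, hn.pos⟩
  rw [sum_eq_card_mul_sum_fiber (permuteColumns n) (MulAction.stabilizer _ z) _
    (fun L => (permOf fun j => L z j)⁻¹), card_stabilizer_perm]
  · congr 1
    rw [numReducedEven, numReducedOdd]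
    simp only [← and_assoc]
    rw [← sum_sign_eq_card_sub_card _ _ fun L _ => latinSign_eq_one_or L, Finset.filter_filter]
    refine Finset.sum_congr ?_ ?_
    · ext L
      rw [Finset.mem_filter, Finset.mem_filter]
      simp only [Finset.mem_univ, true_and, inv_eq_one, IsReducedLatin,
        IsNormalized]
      constructor
      · rintro ⟨⟨hL, h1⟩, h2⟩
        exact ⟨hL, (permOf_eq_one_iff (hL.1 z)).1 h2, h1⟩
      · rintro ⟨hL, h1, h2⟩
        exact ⟨⟨hL, h2⟩, (permOf_eq_one_iff (hL.1 z)).2 h1⟩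
    · intro L hL
      have : permOf (fun j => L z j) = 1 :=
        (permOf_eq_one_iff ((Finset.mem_filter.1 hL).2.1.1 z)).2 (Finset.mem_filter.1 hL).2.2.1
      simp [this]
  · intro L hL
    obtain ⟨hL, h⟩ := (Finset.mem_filter.1 hL).2
    refine inv_mem ?_
    rw [MulAction.mem_stabilizer_iff, Equiv.Perm.smul_def, permOf_apply (hL.1 z), h]
  · intro τ hτ L hL
    obtain ⟨hL, h⟩ := (Finset.mem_filter.1 hL).2
    have hτ' : τ⁻¹ z = z := inv_mem hτ
    simp only [Finset.mem_filter, Finset.mem_univ, true_and]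
    exact ⟨hL.permuteColumns τ, fun i => by rw [permuteColumns_apply, hτ', h]⟩
  · intro τ hτ L hL
    obtain ⟨hL, h⟩ := (Finset.mem_filter.1 hL).2
    simp [hL.permOf_row_permuteColumns]
  · intro τ hτ L hL
    obtain ⟨hL, h⟩ := (Finset.mem_filter.1 hL).2
    rw [hL.latinSign_permuteColumns hn, hL.permOf_row_permuteColumns, Equiv.Perm.sign_mul,
      Equiv.Perm.sign_inv, Units.val_mul]
    linear_combination latinSign L * (Equiv.Perm.sign (permOf fun j => L z j) : ℤ) *
      coe_sign_mul_self τ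

open scoped Classical in
theorem sum_diagonal_eq (hn : 0 < n) :
    ∑ L : Fin n → Fin n → Fin n with IsLatin L ∧ ∀ i, L i i = ⟨0, hn⟩, latinSign L =
      (n - 1).factorial * AT n := by
  set z : Fin n := ⟨0, hn⟩
  rw [sum_eq_card_mul_sum_fiber (permuteSymbols n) (MulAction.stabilizer _ z) _
    (fun L => permOf fun j => L z j), card_stabilizer_perm]
  · congr 1
    rw [AT]
    simp only [← and_assoc]
    rw [← sum_sign_eq_card_sub_card _ _ fun L _ => latinSign_eq_one_or L, Finset.filter_filter]
    refine Finset.sum_congr ?_ fun _ _ => rfl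
    ext L
    rw [Finset.mem_filter, Finset.mem_filter]
    simp only [Finset.mem_univ, true_and, IsNormalized, IsUnipotent]
    constructor
    · rintro ⟨⟨hL, h1⟩, h2⟩
      exact ⟨⟨hL, (permOf_eq_one_iff (hL.1 z)).1 h2⟩, fun i k => by rw [h1, h1]⟩
    · rintro ⟨⟨hL, h1⟩, h2⟩
      exact ⟨⟨hL, fun i => (h2 i z).trans (h1 z)⟩, (permOf_eq_one_iff (hL.1 z)).2 h1⟩
  · intro L hL
    obtain ⟨hL, h⟩ := (Finset.mem_filter.1 hL).2
    rw [MulAction.mem_stabilizer_iff, Equiv.Perm.smul_def, permOf_apply (hL.1 z), h]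
  · intro τ hτ L hL
    obtain ⟨hL, h⟩ := (Finset.mem_filter.1 hL).2
    simp only [Finset.mem_filter, Finset.mem_univ, true_and]
    exact ⟨hL.permuteSymbols τ, fun i => by rw [permuteSymbols_apply, h]; exact hτ⟩
  · intro τ hτ L hL
    exact permOf_mul_left ((Finset.mem_filter.1 hL).2.1.1 z) τ
  · intro τ hτ L hL
    exact (Finset.mem_filter.1 hL).2.1.latinSign_permuteSymbols τ

open scoped Classical in
theorem sum_latinSign_mul_sign_symPerm_eq (hn : Odd n) :
    ∑ L : Fin n → Fin n → Fin n with IsLatin L,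
        latinSign L * Equiv.Perm.sign (symPerm L ⟨0, hn.pos⟩) =
      n.factorial * ((n - 1).factorial * AT n) := by
  rw [← sum_diagonal_eq hn.pos]
  set z : Fin n := ⟨0, hn.pos⟩
  rw [sum_eq_card_mul_sum_fiber (permuteColumns n) ⊤ _ (fun L => symPerm L z)]
  · congr 1
    · simp [Fintype.card_perm]
    · rw [Finset.filter_filter]
      have h : ∀ L : Fin n → Fin n → Fin n, IsLatin L ∧ symPerm L z = 1 ↔
          IsLatin L ∧ ∀ i, L i i = z := by
        intro L
        refine and_congr_right fun hL => ?_
        simp [Equiv.ext_iff, hL.symPerm_apply_eq_iff]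
      refine Finset.sum_congr (Finset.filter_congr fun L _ => h L) fun L hL => ?_
      rw [((h L).2 (Finset.mem_filter.1 hL).2).2]
      simp
  · simp
  · intro τ _ L hL
    simpa using (Finset.mem_filter.1 hL).2.permuteColumns τ
  · intro τ _ L hL
    exact (Finset.mem_filter.1 hL).2.symPerm_permuteColumns τ z
  · intro τ _ L hL
    have hL := (Finset.mem_filter.1 hL).2
    rw [hL.latinSign_permuteColumns hn, hL.symPerm_permuteColumns, Equiv.Perm.sign_mul,
      Units.val_mul]
    linear_combination latinSign L * (Equiv.Perm.sign (symPerm L z) : ℤ) * coe_sign_mul_self τ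

theorem IsLatin.symPerm_isLatin {L : Fin n → Fin n → Fin n} (hL : IsLatin L) :
    IsLatin fun s i => symPerm L s i := by
  refine ⟨fun s => (symPerm L s).bijective, fun i => Finite.injective_iff_bijective.1 ?_⟩
  intro s t h
  rw [← hL.apply_symPerm s i, ← hL.apply_symPerm t i]
  exact congrArg (L i) h

/-- The array with entry `s` in position `(i, j)` whenever `M` has entry `j` in
position `(s, i)`. -/
noncomputable def ofSymPerms (M : Fin n → Fin n → Fin n) : Fin n → Fin n → Fin n :=
  fun i j => (permOf fun s => M s i).symm j

theorem IsLatin.ofSymPerms_eq_iff {M : Fin n → Fin n → Fin n} (hM : IsLatin M)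
    (i j s : Fin n) : ofSymPerms M i j = s ↔ M s i = j := by
  rw [ofSymPerms, Equiv.symm_apply_eq, permOf_apply (hM.2 i), eq_comm]

theorem IsLatin.ofSymPerms_isLatin {M : Fin n → Fin n → Fin n} (hM : IsLatin M) :
    IsLatin (ofSymPerms M) := by
  refine ⟨fun i => (permOf fun s => M s i).symm.bijective,
    fun j => Finite.injective_iff_bijective.1 fun i k h => ?_⟩
  have h1 := (hM.ofSymPerms_eq_iff i j _).1 rfl
  have h2 := (hM.ofSymPerms_eq_iff k j _).1 rfl
  rw [← h] at h2
  exact (hM.1 _).1 (h1.trans h2.symm)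

open scoped Classical in
theorem sum_rowSign_mul_sign_row_eq (hn : Odd n) :
    ∑ M : Fin n → Fin n → Fin n with IsLatin M,
        rowSign M * Equiv.Perm.sign (permOf fun j => M ⟨0, hn.pos⟩ j) =
      (-1) ^ (n * (n - 1) / 2) * (n.factorial * ((n - 1).factorial * AT n)) := by
  rw [← sum_latinSign_mul_sign_symPerm_eq hn, Finset.mul_sum]
  symm
  refine Finset.sum_nbij' (fun L s i => symPerm L s i) ofSymPerms ?_ ?_ ?_ ?_ ?_
  · intro L hL
    simpa using (Finset.mem_filter.1 hL).2.symPerm_isLatin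
  · intro M hM
    simpa using (Finset.mem_filter.1 hM).2.ofSymPerms_isLatin
  · intro L hL
    have hL := (Finset.mem_filter.1 hL).2
    ext1 i
    ext1 j
    rw [hL.symPerm_isLatin.ofSymPerms_eq_iff, hL.symPerm_apply_eq_iff]
  · intro M hM
    have hM := (Finset.mem_filter.1 hM).2
    ext1 s
    ext1 i
    rw [hM.ofSymPerms_isLatin.symPerm_apply_eq_iff, hM.ofSymPerms_eq_iff]
  · intro L hL
    have hL := (Finset.mem_filter.1 hL).2
    simp only [rowSign, permOf_coe]
    rw [← mul_assoc, ← hL.symbolSign_eq, symbolSign]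

end LatinSums

section Polynomial

open MvPolynomial

variable {n : ℕ}

theorem coeff_allOnes_prod_X (g : Fin n × Fin n → Fin n × Fin n)
    [Decidable (Function.Bijective g)] :
    coeff (allOnes n) (∏ p, (X (g p) : MvPolynomial (Fin n × Fin n) ℤ)) =
      if Function.Bijective g then 1 else 0 := by
  classical
  have h : (∏ p, (X (g p) : MvPolynomial (Fin n × Fin n) ℤ)) =
      monomial (∑ p, Finsupp.single (g p) 1) 1 := by
    rw [monomial_sum_one]
    rfl
  rw [h, coeff_monomial]
  refine if_congr ?_ rfl rfl
  constructor
  · intro h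
    refine Finite.surjective_iff_bijective.1 fun q => ?_
    by_contra! hq
    have := DFunLike.congr_fun h q
    simp [allOnes, Finsupp.finsetSum_apply, hq] at this
  · intro hg
    ext q
    obtain ⟨p, rfl⟩ := hg.2 q
    simp [allOnes, Finsupp.finsetSum_apply, Finsupp.single_apply, hg.1.eq_iff]

/-- The signed sum over `σ` of `∏ X (σ i j) (f i j)`; row `z` of the array contributes a
permanent, every other row a determinant. -/
noncomputable def rowExpansion (z : Fin n) (f : Fin n → Fin n → Fin n) :
    MvPolynomial (Fin n × Fin n) ℤ :=
  ∑ σ : Fin n → Equiv.Perm (Fin n),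
    (((Equiv.Perm.sign (σ z) : ℤ) * ∏ i, (Equiv.Perm.sign (σ i) : ℤ) : ℤ) :
      MvPolynomial (Fin n × Fin n) ℤ) * ∏ i, ∏ j, X (σ i j, f i j)

theorem rowExpansion_comp_perm (z : Fin n) (f : Fin n → Fin n → Fin n)
    (g : Fin n → Equiv.Perm (Fin n)) :
    rowExpansion z (fun i j => f i (g i j)) =
      (((Equiv.Perm.sign (g z) : ℤ) * ∏ i, (Equiv.Perm.sign (g i) : ℤ) : ℤ) :
        MvPolynomial (Fin n × Fin n) ℤ) * rowExpansion z f := by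
  rw [rowExpansion, rowExpansion, ← Equiv.sum_comp (Equiv.mulRight g), Finset.mul_sum]
  refine Finset.sum_congr rfl fun σ _ => ?_
  have h : ∏ i, ∏ j, (X ((σ i * g i) j, f i (g i j)) : MvPolynomial (Fin n × Fin n) ℤ) =
      ∏ i, ∏ j, X (σ i j, f i j) :=
    Finset.prod_congr rfl fun i _ => Equiv.prod_comp (g i) fun j =>
      (X (σ i j, f i j) : MvPolynomial (Fin n × Fin n) ℤ)
  simp only [Equiv.coe_mulRight, Pi.mul_apply, h, Equiv.Perm.sign_mul, Units.val_mul,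
    Finset.prod_mul_distrib, Int.cast_mul]
  ring

theorem rowExpansion_eq_zero {z : Fin n} {f : Fin n → Fin n → Fin n} {i : Fin n} (hi : i ≠ z)
    (hf : ¬ Function.Injective (f i)) : rowExpansion z f = 0 := by
  rw [Function.not_injective_iff] at hf
  obtain ⟨a, b, hab, hne⟩ := hf
  have h := rowExpansion_comp_perm z f (Function.update 1 i (Equiv.swap a b))
  have hfg : (fun k j => f k ((Function.update 1 i (Equiv.swap a b) :
      Fin n → Equiv.Perm (Fin n)) k j)) = f := by
    ext1 k
    ext1 j
    rcases eq_or_ne k i with rfl | hk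
    · rw [Function.update_self, Equiv.swap_apply_def]
      split_ifs with h1 h2
      · rw [h1, hab]
      · rw [h2, hab]
      · rfl
    · rw [Function.update_of_ne hk]
      rfl
  have hp : ∏ k, (Equiv.Perm.sign ((Function.update 1 i (Equiv.swap a b) :
      Fin n → Equiv.Perm (Fin n)) k) : ℤ) = -1 := by
    rw [Finset.prod_eq_single i]
    · simp [Equiv.Perm.sign_swap hne]
    · intro k _ hk
      simp [Function.update_of_ne hk]
    · simp
  rw [hfg, hp, Function.update_of_ne hi.symm] at h
  simp only [Pi.one_apply, Equiv.Perm.sign_one, Units.val_one, one_mul, Int.cast_neg,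
    Int.cast_one, neg_mul] at h
  exact self_eq_neg.1 h

theorem IsLatin.rowExpansion_eq {L : Fin n → Fin n → Fin n} (hL : IsLatin L) (z : Fin n) :
    rowExpansion z L =
      (((Equiv.Perm.sign (permOf fun j => L z j) : ℤ) * rowSign L : ℤ) :
        MvPolynomial (Fin n × Fin n) ℤ) * rowExpansion z (fun _ j => j) := by
  rw [rowSign, ← rowExpansion_comp_perm z (fun _ j => j) fun i => permOf fun j => L i j]
  simp only [permOf_apply (hL.1 _)]

open scoped Classical in
theorem coeff_rowExpansion_id (hn : Odd n) :
    coeff (allOnes n) (rowExpansion ⟨0, hn.pos⟩ fun _ j : Fin n => j) =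
      (-1) ^ (n * (n - 1) / 2) * (n.factorial * ((n - 1).factorial * AT n)) := by
  rw [← sum_rowSign_mul_sign_row_eq hn, rowExpansion, coeff_sum]
  have hb : ∀ σ : Fin n → Equiv.Perm (Fin n),
      Function.Bijective (fun p : Fin n × Fin n => (σ p.1 p.2, p.2)) ↔
        IsLatin fun i j => σ i j := by
    intro σ
    constructor
    · intro h
      refine ⟨fun i => (σ i).bijective, fun j => Finite.injective_iff_bijective.1 ?_⟩
      intro i k hik
      exact congrArg Prod.fst (@h.1 (i, j) (k, j) (Prod.ext hik rfl))
    · intro h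
      refine Finite.injective_iff_bijective.1 ?_
      rintro ⟨i, j⟩ ⟨k, l⟩ hik
      obtain ⟨h1, rfl⟩ := Prod.ext_iff.1 hik
      exact Prod.ext ((h.2 j).1 h1) rfl
  have hc : ∀ σ : Fin n → Equiv.Perm (Fin n),
      coeff (allOnes n) ((((Equiv.Perm.sign (σ ⟨0, hn.pos⟩) : ℤ) *
          ∏ i, (Equiv.Perm.sign (σ i) : ℤ) : ℤ) : MvPolynomial (Fin n × Fin n) ℤ) *
          ∏ i, ∏ j, X (σ i j, j)) =
        if IsLatin fun i j => σ i j then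
          rowSign (fun i j => σ i j) *
            Equiv.Perm.sign (permOf fun j => σ ⟨0, hn.pos⟩ j) else 0 := by
    intro σ
    rw [← Fintype.prod_prod_type' (f := fun i j =>
        (X (σ i j, j) : MvPolynomial (Fin n × Fin n) ℤ)),
      ← map_intCast (C : ℤ →+* MvPolynomial (Fin n × Fin n) ℤ),
      coeff_C_mul, coeff_allOnes_prod_X fun p : Fin n × Fin n => (σ p.1 p.2, p.2),
      if_congr (hb σ) rfl rfl]
    simp only [permOf_coe, rowSign]
    split_ifs <;> simp [mul_comm]
  rw [Finset.sum_congr rfl fun σ _ => hc σ, ← Finset.sum_filter]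
  refine Finset.sum_nbij' (fun σ i j => σ i j) (fun L i => permOf fun j => L i j) ?_ ?_ ?_ ?_ ?_
  · intro σ hσ
    simpa using hσ
  · intro L hL
    have hL := (Finset.mem_filter.1 hL).2
    simpa [permOf_apply (hL.1 _)] using hL
  · intro σ _
    ext1 i
    exact permOf_coe _
  · intro L hL
    have hL := (Finset.mem_filter.1 hL).2
    simp only [permOf_apply (hL.1 _)]
  · intro σ _
    rfl

/-- If all columns of an array are permutations and so are all rows but one, then the array is
a Latin square. -/
theorem isLatin_of_rows_of_ne {L : Fin n → Fin n → Fin n} (z : Fin n)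
    (hc : ∀ j, Function.Bijective fun i => L i j)
    (hr : ∀ i, i ≠ z → Function.Injective (L i)) : IsLatin L := by
  refine ⟨fun i => ?_, hc⟩
  rcases ne_or_eq i z with hi | rfl
  · exact Finite.injective_iff_bijective.1 (hr i hi)
  · refine Finite.surjective_iff_bijective.1 fun s => ?_
    by_contra! hs
    choose r hrs using fun j => (hc j).2 s
    have hne : ∀ j, r j ≠ i := fun j h => hs j (h ▸ hrs j)
    have hinj : Function.Injective r := fun j k h =>
      hr (r j) (hne j) ((hrs j).trans (by rw [h]; exact (hrs k).symm))
    obtain ⟨j, hj⟩ := Finite.injective_iff_surjective.1 hinj i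
    exact hne j hj

open scoped Classical in
theorem sum_sign_mul_rowExpansion (z : Fin n) :
    ∑ ρ : Fin n → Equiv.Perm (Fin n) with ρ z = 1,
        ((∏ j, (Equiv.Perm.sign (ρ j) : ℤ) : ℤ) : MvPolynomial (Fin n × Fin n) ℤ) *
          rowExpansion z (fun i j => ρ j i) =
      ((∑ L : Fin n → Fin n → Fin n with IsLatin L ∧ ∀ i, L i z = i,
        latinSign L * Equiv.Perm.sign (permOf fun j => L z j) : ℤ) :
          MvPolynomial (Fin n × Fin n) ℤ) * rowExpansion z (fun _ j => j) := by
  rw [← Finset.sum_filter_of_ne (p := fun ρ => IsLatin fun i j => ρ j i), Finset.filter_filter,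
    Int.cast_sum, Finset.sum_mul]
  · refine Finset.sum_nbij' (fun ρ i j => ρ j i) (fun L j => permOf fun i => L i j) ?_ ?_ ?_ ?_ ?_
    · intro ρ hρ
      obtain ⟨h1, h2⟩ := (Finset.mem_filter.1 hρ).2
      simp [h1, h2]
    · intro L hL
      obtain ⟨h1, h2⟩ := (Finset.mem_filter.1 hL).2
      exact Finset.mem_filter.2 ⟨Finset.mem_univ _, (permOf_eq_one_iff (h1.2 z)).2 h2,
        by simpa only [permOf_apply (h1.2 _)] using h1⟩
    · intro ρ _
      ext1 j
      exact permOf_coe _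
    · intro L hL
      have hL := (Finset.mem_filter.1 hL).2.1
      simp only [permOf_apply (hL.2 _)]
    · intro ρ hρ
      rw [(Finset.mem_filter.1 hρ).2.2.rowExpansion_eq, latinSign, colSign]
      simp only [permOf_coe, Int.cast_mul]
      ring
  · intro ρ _ hne
    refine isLatin_of_rows_of_ne z (fun j => (ρ j).bijective) fun i hi => ?_
    by_contra hinj
    exact hne (by rw [rowExpansion_eq_zero hi hinj, mul_zero])

end Polynomial

/-- For odd `n`, the coefficient of `∏_{i,j} X i j` in
`∑_{ρ,σ, ρ₁ = id} ε(σ₁) (∏ᵢ ε(σᵢ)) (∏ⱼ ε(ρⱼ)) ∏_{i,j} X (σᵢ j) (ρⱼ i)` equals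
`(-1)^{n(n-1)/2} n! ((n-1)!)² AT(n) (R_n^E - R_n^O)`. -/
theorem coeff_sum_perm_products_eq (n : ℕ) (hn : Odd n) :
    MvPolynomial.coeff (allOnes n)
      (∑ ρ ∈ Finset.univ.filter
          (fun ρ : Fin n → Equiv.Perm (Fin n) => ρ ⟨0, hn.pos⟩ = 1),
        ∑ σ : Fin n → Equiv.Perm (Fin n),
          ((Equiv.Perm.sign (σ ⟨0, hn.pos⟩) : ℤ) : MvPolynomial (Fin n × Fin n) ℤ) *
            (∏ i, ((Equiv.Perm.sign (σ i) : ℤ) : MvPolynomial (Fin n × Fin n) ℤ)) *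
            (∏ j, ((Equiv.Perm.sign (ρ j) : ℤ) : MvPolynomial (Fin n × Fin n) ℤ)) *
            ∏ i, ∏ j, MvPolynomial.X (σ i j, ρ j i))
      = (-1) ^ (n * (n - 1) / 2) * n.factorial * ((n - 1).factorial : ℤ) ^ 2 *
          AT n * ((numReducedEven n : ℤ) - numReducedOdd n) := by
  have hsum := sum_sign_mul_rowExpansion (⟨0, hn.pos⟩ : Fin n)
  rw [sum_firstColumn_eq hn] at hsum
  have hcoeff := congrArg (MvPolynomial.coeff (allOnes n)) hsum
  rw [← map_intCast (MvPolynomial.C : ℤ →+* MvPolynomial (Fin n × Fin n) ℤ),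
    MvPolynomial.coeff_C_mul, coeff_rowExpansion_id hn] at hcoeff
  refine Eq.trans ?_ (hcoeff.trans ?_)
  · congr 1
    refine Finset.sum_congr (by congr) fun ρ _ => ?_
    rw [rowExpansion, Finset.mul_sum]
    refine Finset.sum_congr rfl fun σ _ => ?_
    push_cast
    ring
  · push_cast
    ring
end

section
/- Let p be an odd prime. Let B_p^† be a set of p×p (0,1)-matrices containing exactly one representative of each equivalence class of p×p (0,1)-matrices under row permutation (i.e., for every p×p (0,1)-matrix A there is exactly one A' ∈ B_p^† obtained from A by permuting its rows). Then Σ (−1)^{σ0(A)} per(A) ≡ −1 (mod p), where the sum is over all A ∈ B_p^† with det(A) ≢ 0 (mod p). -/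
/-- If a group of order `p` acts on a finite type, an invariant function with values in a ring of
characteristic `p` has the same sum over the whole type as over the fixed points. -/
theorem sum_eq_sum_fixed_of_card_eq_prime {p : ℕ} [Fact p.Prime] {G X R : Type*} [AddGroup G]
    [Fintype X] [DecidableEq X] [CommRing R] [CharP R p] (hG : Nat.card G = p)
    (φ : G → X → X) (φ_zero : ∀ x, φ 0 x = x) (φ_add : ∀ g h x, φ (g + h) x = φ g (φ h x))
    [DecidablePred fun x => ∀ g, φ g x = x] (f : X → R) (hf : ∀ g x, f (φ g x) = f x) :
    ∑ x, f x = ∑ x with ∀ g, φ g x = x, f x := by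
  classical
  have hp : IsPGroup p (Multiplicative G) := IsPGroup.of_card (n := 1)
    (by simpa [Nat.card_congr Multiplicative.toAdd] using hG)
  have fiber (c : R) : ((Finset.univ.filter fun x => f x = c).card : R) =
      (((Finset.univ.filter fun x => ∀ g, φ g x = x).filter fun x => f x = c).card : R) := by
    let : MulAction (Multiplicative G) {x // f x = c} :=
      { smul := fun g x => ⟨φ g.toAdd x, (hf _ _).trans x.2⟩
        one_smul := fun x => Subtype.ext (φ_zero _)
        mul_smul := fun g h x => Subtype.ext (φ_add _ _ _) }
    have hcard := hp.card_modEq_card_fixedPoints {x // f x = c}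
    have e : MulAction.fixedPoints (Multiplicative G) {x // f x = c} ≃
        {x // (∀ g, φ g x = x) ∧ f x = c} :=
      { toFun := fun x => ⟨x.1.1, fun g => congrArg Subtype.val (x.2 (Multiplicative.ofAdd g)), x.1.2⟩
        invFun := fun x => ⟨⟨x.1, x.2.2⟩, fun g => Subtype.ext (x.2.1 g.toAdd)⟩
        left_inv := fun _ => rfl
        right_inv := fun _ => rfl }
    rw [Nat.card_congr e, Nat.card_eq_fintype_card, Nat.card_eq_fintype_card,
      Fintype.card_subtype, Fintype.card_subtype] at hcard
    rw [Finset.filter_filter]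
    exact (CharP.natCast_eq_natCast R p).2 hcard
  rw [← Finset.sum_fiberwise_of_maps_to (t := Finset.univ.image f) (g := f) (by simp),
    ← Finset.sum_fiberwise_of_maps_to (s := Finset.univ.filter fun x => ∀ g, φ g x = x)
      (t := Finset.univ.image f) (g := f) (by simp)]
  refine Finset.sum_congr rfl fun c _ => ?_
  rw [Finset.sum_congr rfl fun x hx => (Finset.mem_filter.1 hx).2,
    Finset.sum_congr rfl fun x hx => (Finset.mem_filter.1 hx).2, Finset.sum_const,
    Finset.sum_const, nsmul_eq_mul, nsmul_eq_mul, fiber]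

/-- Translations of a group of odd order are even permutations. -/
theorem sign_addRight_of_odd_card {G : Type*} [AddGroup G] [Fintype G] [DecidableEq G]
    (hG : Odd (Fintype.card G)) (c : G) : Equiv.Perm.sign (Equiv.addRight c) = 1 := by
  have h : Equiv.addRight c ^ Fintype.card G = 1 := by
    simp
  have := congrArg Equiv.Perm.sign h
  rw [map_pow, map_one] at this
  rcases Int.units_eq_one_or (Equiv.Perm.sign (Equiv.addRight c)) with h1 | h1
  · exact h1
  · rw [h1, hG.neg_one_pow] at this
    exact absurd this (by decide)

/-- Over `ZMod p` with `p` odd, the determinant of a `p × p` circulant matrix is the sum of the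
entries of its first column. -/
theorem det_circulant_eq_sum {p : ℕ} [Fact p.Prime] (hodd : Odd p) {G : Type*} [AddCommGroup G]
    [Fintype G] [DecidableEq G] (hG : Fintype.card G = p) (a : G → ZMod p) :
    (Matrix.circulant a).det = ∑ c, a c := by
  classical
  rw [Matrix.det_apply', sum_eq_sum_fixed_of_card_eq_prime (p := p) (G := G)
    (by rw [Nat.card_eq_fintype_card, hG])
    (fun g σ => Equiv.addRight g * σ * (Equiv.addRight g)⁻¹)]
  · symm
    refine Finset.sum_bij (fun c _ => Equiv.addRight c) ?_ ?_ ?_ ?_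
    · intro c _
      simp only [Finset.mem_filter, Finset.mem_univ, true_and]
      intro g
      ext x
      simp
      abel
    · intro c _ d _ h
      simpa using congrArg (fun σ : Equiv.Perm G => σ 0) h
    · intro σ hσ
      simp only [Finset.mem_filter, Finset.mem_univ, true_and] at hσ
      refine ⟨σ 0, Finset.mem_univ _, ?_⟩
      ext x
      have := congrArg (fun τ : Equiv.Perm G => τ x) (hσ x)
      simp at this
      rw [← this]
      simp [add_comm]
    · intro c _
      rw [sign_addRight_of_odd_card (hG ▸ hodd)]
      simp [hG]
  · intro σ
    ext x
    simp
  · intro g h σ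
    ext x
    simp [add_comm g h, add_assoc]
  · intro g σ
    simp only [map_mul, map_inv]
    congr 1
    · rw [mul_right_comm, mul_inv_cancel, one_mul]
    · rw [← Equiv.prod_comp (Equiv.addRight g)]
      simp

/-- The `(0,1)`-matrix over `R` associated to a Boolean matrix. -/
def boolMatrix (R : Type*) [Zero R] [One R] {n : Type*} (A : n → n → Bool) : Matrix n n R :=
  Matrix.of fun i j => if A i j then 1 else 0

/-- The summand `(-1)^{σ₀(A)} ∏ i, A i i`, kept only when `det A ≠ 0`. -/
noncomputable def diagWeight (R : Type*) [CommRing R] [DecidableEq R] {n : Type*} [Fintype n]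
    [DecidableEq n] (A : n → n → Bool) : R :=
  if (boolMatrix R A).det = 0 then 0
  else (∏ i, ∏ j, if A i j then 1 else -1) * ∏ i, if A i i then 1 else 0

/-- The weight is invariant under simultaneous permutations of rows and columns. -/
theorem diagWeight_permute {R : Type*} [CommRing R] [DecidableEq R] {n : Type*} [Fintype n]
    [DecidableEq n] (e : Equiv.Perm n) (A : n → n → Bool) :
    diagWeight R (fun i j => A (e i) (e j)) = diagWeight R A := by
  have hdet : (boolMatrix R fun i j => A (e i) (e j)).det = (boolMatrix R A).det :=
    Matrix.det_submatrix_equiv_self e (boolMatrix R A)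
  unfold diagWeight
  rw [hdet, ← Equiv.prod_comp e fun i => ∏ j, if A i j then (1 : R) else -1,
    ← Equiv.prod_comp e fun i => if A i i then (1 : R) else 0]
  simp_rw [← fun i => Equiv.prod_comp e fun j => if A (e i) j then (1 : R) else -1]

/-- The weight of a circulant matrix of odd prime order `p` over `ZMod p`. -/
theorem diagWeight_circulant {p : ℕ} [Fact p.Prime] (hodd : Odd p) {G : Type*} [AddCommGroup G]
    [Fintype G] [DecidableEq G] (hG : Fintype.card G = p) (a : G → Bool) :
    diagWeight (ZMod p) (fun i j => a (i - j)) =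
      (∏ i, if a i then 1 else -1) * (if a 0 then 1 else 0) -
        if a = fun _ => true then 1 else 0 := by
  have hdet : (boolMatrix (ZMod p) fun i j => a (i - j)).det =
      ((Finset.univ.filter fun c => a c = true).card : ZMod p) :=
    (det_circulant_eq_sum hodd hG fun c => if a c then 1 else 0).trans
      (Finset.sum_boole _ _)
  have hprod : (∏ i, ∏ j, if a (i - j) then (1 : ZMod p) else -1) =
      ∏ i, if a i then 1 else -1 := by
    have hrow (i : G) : (∏ j, if a (i - j) then (1 : ZMod p) else -1) =
        ∏ k, if a k then 1 else -1 :=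
      Equiv.prod_comp (Equiv.subLeft i) fun k => if a k then (1 : ZMod p) else -1
    simp_rw [hrow]
    simp [hG]
  unfold diagWeight
  rw [hdet, hprod]
  rcases Bool.eq_false_or_eq_true (a 0) with h0 | h0
  · by_cases ha : a = fun _ => true
    · simp [ha, hG]
    · have hlt : (Finset.univ.filter fun c => a c = true).card < p := by
        rw [← hG]
        refine Finset.card_lt_univ_of_notMem (x := (Function.ne_iff.1 ha).choose) ?_
        simpa using (Function.ne_iff.1 ha).choose_spec
      have hpos : 0 < (Finset.univ.filter fun c => a c = true).card :=
        Finset.card_pos.2 ⟨0, by simp [h0]⟩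
      rw [if_neg, if_neg ha]
      · simp [h0]
      · rw [CharP.cast_eq_zero_iff (ZMod p) p]
        exact fun h => absurd (Nat.le_of_dvd hpos h) (not_le.2 hlt)
  · have ha : a ≠ fun _ => true := fun h => by simp [h] at h0
    have : NeZero p := ⟨(Fact.out : p.Prime).ne_zero⟩
    simp [h0, ha, hG]

/-- The signed sum over the Boolean vectors with a prescribed `true` coordinate vanishes. -/
theorem sum_prod_sign_mul_apply {R : Type*} [CommRing R] {n : Type*} [Fintype n] [DecidableEq n]
    [Nontrivial n] (k : n) :
    ∑ a : n → Bool, (∏ i, if a i then (1 : R) else -1) * (if a k then 1 else 0) = 0 := by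
  obtain ⟨l, hl⟩ := exists_ne k
  have h (a : n → Bool) : (∏ i, if a i then (1 : R) else -1) * (if a k then 1 else 0) =
      ∏ i, (if a i then (1 : R) else -1) * (if i = k then if a i then 1 else 0 else 1) := by
    rw [Finset.prod_mul_distrib, Fintype.prod_ite_eq']
  rw [Finset.sum_congr rfl fun a _ => h a,
    ← Fintype.prod_sum fun i (b : Bool) =>
      (if b then (1 : R) else -1) * (if i = k then if b then 1 else 0 else 1)]
  exact Finset.prod_eq_zero (Finset.mem_univ l) (by simp [hl])

/-- The weights of all Boolean matrices of odd prime order `p` add up to `-1` in `ZMod p`. -/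
theorem sum_diagWeight {p : ℕ} [Fact p.Prime] (hodd : Odd p) {G : Type*} [AddCommGroup G]
    [Fintype G] [DecidableEq G] (hG : Fintype.card G = p) :
    ∑ A : G → G → Bool, diagWeight (ZMod p) A = -1 := by
  classical
  have : Nontrivial G := Fintype.one_lt_card_iff_nontrivial.1 (hG ▸ (Fact.out : p.Prime).one_lt)
  rw [sum_eq_sum_fixed_of_card_eq_prime (p := p) (G := G)
    (by rw [Nat.card_eq_fintype_card, hG]) (fun g A i j => A (i + g) (j + g))]
  · trans ∑ a : G → Bool, diagWeight (ZMod p) fun i j => a (i - j)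
    · symm
      refine Finset.sum_bij (fun a _ i j => a (i - j)) (by simp) ?_ ?_ fun _ _ => rfl
      · intro a _ b _ h
        funext i
        simpa using congrFun (congrFun h i) 0
      · intro A hA
        simp only [Finset.mem_filter, Finset.mem_univ, true_and] at hA
        refine ⟨fun i => A i 0, Finset.mem_univ _, ?_⟩
        funext i j
        simpa using (congrFun (congrFun (hA j) (i - j)) 0).symm
    · simp_rw [diagWeight_circulant hodd hG, Finset.sum_sub_distrib, sum_prod_sign_mul_apply]
      simp
  · simp
  · intro g h A
    funext i j
    simp [add_assoc, add_comm g h, add_left_comm]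
  · exact fun g A => diagWeight_permute (Equiv.addRight g) A

/-- The sign `(-1)^{σ₀(A)}` as a product over the entries of `A`. -/
theorem neg_one_pow_sigma0 {R : Type*} [CommRing R] {n : ℕ} (A : Fin n → Fin n → Bool) :
    (-1 : R) ^ sigma0 A = ∏ i, ∏ j, if A i j then 1 else -1 := by
  rw [← Fintype.prod_prod_type' fun i j => if A i j then (1 : R) else -1, sigma0,
    ← Finset.prod_const, Finset.prod_filter]
  exact Finset.prod_congr rfl fun x _ => by cases A x.1 x.2 <;> simp

/-- The signed permanent of a nonsingular Boolean matrix is the sum of the weights of its row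
permutations. -/
theorem sum_diagWeight_permute_rows {R : Type*} [CommRing R] [DecidableEq R] {n : ℕ}
    (A : Fin n → Fin n → Bool) (hA : (boolMatrix R A).det ≠ 0) :
    ∑ σ : Equiv.Perm (Fin n), diagWeight R (fun i j => A (σ i) j) =
      (-1) ^ sigma0 A * (boolMatrix R A).permanent := by
  rw [Matrix.permanent, Finset.mul_sum]
  refine Finset.sum_congr rfl fun σ _ => ?_
  have hdet : (boolMatrix R fun i j => A (σ i) j).det ≠ 0 := by
    change ((boolMatrix R A).submatrix σ id).det ≠ 0
    rw [Matrix.det_permute]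
    rcases Int.units_eq_one_or (Equiv.Perm.sign σ) with h | h <;> simpa [h] using hA
  rw [diagWeight, if_neg hdet, neg_one_pow_sigma0,
    ← Equiv.prod_comp σ fun i => ∏ j, if A i j then (1 : R) else -1]
  rfl

/-- For an odd prime `p` and a transversal `T` of the row-permutation classes of
`p × p` `(0,1)`-matrices,
`∑_{A ∈ T, det A ≢ 0 (mod p)} (-1)^{σ₀(A)} per(A) ≡ -1 (mod p)`. -/
theorem sum_representatives_permanent_mod (p : ℕ) (hp : p.Prime) (hodd : Odd p)
    (T : Finset (Fin p → Fin p → Bool))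
    (hT : ∀ A : Fin p → Fin p → Bool, ∃! A' : Fin p → Fin p → Bool,
      A' ∈ T ∧ ∃ π : Equiv.Perm (Fin p), ∀ i j, A' i j = A (π i) j) :
    ∑ A ∈ T.filter (fun A => ¬ (toInt A).det ≡ 0 [ZMOD (p : ℤ)]),
        (-1 : ℤ) ^ sigma0 A * (toInt A).permanent ≡ -1 [ZMOD (p : ℤ)] := by
  have : Fact p.Prime := ⟨hp⟩
  have : NeZero p := ⟨hp.ne_zero⟩
  have hmap (A : Fin p → Fin p → Bool) :
      (toInt A).map (Int.castRingHom (ZMod p)) = boolMatrix (ZMod p) A := by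
    ext i j
    simp [toInt, boolMatrix, apply_ite]
  have hdet (A : Fin p → Fin p → Bool) :
      (((toInt A).det : ℤ) : ZMod p) = (boolMatrix (ZMod p) A).det := by
    rw [← hmap]
    exact (Int.castRingHom (ZMod p)).map_det (toInt A)
  have hper (A : Fin p → Fin p → Bool) :
      (((toInt A).permanent : ℤ) : ZMod p) = (boolMatrix (ZMod p) A).permanent := by
    simp [← hmap, Matrix.permanent]
  have hmem (A : Fin p → Fin p → Bool) :
      ¬ (toInt A).det ≡ 0 [ZMOD (p : ℤ)] ↔ (boolMatrix (ZMod p) A).det ≠ 0 := by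
    rw [← ZMod.intCast_eq_intCast_iff, hdet, Int.cast_zero]
  rw [← ZMod.intCast_eq_intCast_iff]
  push_cast
  refine Eq.trans ?_ (sum_diagWeight hodd (Fintype.card_fin p))
  simp_rw [hmem, hper]
  rw [Finset.sum_congr rfl fun A hA =>
    (sum_diagWeight_permute_rows A (Finset.mem_filter.1 hA).2).symm, ← Finset.sum_product']
  refine Finset.sum_of_injOn (fun x i j => x.1 (x.2 i) j) ?_ (by simp) ?_ fun _ _ => rfl
  · rintro ⟨A, σ⟩ hA ⟨B, τ⟩ hB h
    simp only [Finset.coe_product, Finset.coe_filter, Finset.coe_univ, Set.mem_prod,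
      Set.mem_ofPred_eq, Set.mem_univ, and_true] at hA hB
    have h' (i j) : A (σ i) j = B (τ i) j := congrFun (congrFun h i) j
    obtain rfl : A = B := (hT B).unique
      ⟨hA.1, σ⁻¹.trans τ, fun i j => by simpa using h' (σ⁻¹ i) j⟩ ⟨hB.1, 1, fun _ _ => rfl⟩
    congr 1
    ext i
    congr 1
    by_contra hne
    exact hA.2 (Matrix.det_zero_of_row_eq hne (by
      funext j
      simp [boolMatrix, h' i j]))
  · intro A _ hA
    by_contra hne
    have hdetA : (boolMatrix (ZMod p) A).det ≠ 0 := fun h => hne (by simp [diagWeight, h])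
    obtain ⟨B, ⟨hB, π, hπ⟩, -⟩ := hT A
    refine hA ⟨(B, π⁻¹), ?_, ?_⟩
    · simp only [Finset.coe_product, Finset.coe_filter, Finset.coe_univ, Set.mem_prod,
        Set.mem_ofPred_eq, Set.mem_univ, and_true]
      refine ⟨hB, ?_⟩
      have hsub : boolMatrix (ZMod p) B = (boolMatrix (ZMod p) A).submatrix π id := by
        ext i j
        simp [boolMatrix, hπ]
      rw [hsub, Matrix.det_permute]
      rcases Int.units_eq_one_or (Equiv.Perm.sign π) with h | h <;> simpa [h] using hdetA
    · funext i j
      simp [hπ]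
end

section
/- Let n be odd. Then for every π ∈ Sym(n), ε(π)·(L_n^CE(π) − L_n^CO(π)) = L_n^CE(id) − L_n^CO(id). -/
theorem permOf_perm_comp {n : ℕ} (σ : Equiv.Perm (Fin n)) {f : Fin n → Fin n}
    (hf : Function.Bijective f) : permOf (fun i => σ (f i)) = σ * permOf f := by
  have h : Function.Bijective fun i => σ (f i) := σ.bijective.comp hf
  rw [permOf, permOf, dif_pos h, dif_pos hf]
  exact Equiv.ext fun _ => rfl

theorem IsLatin.perm_comp {n : ℕ} {L : Fin n → Fin n → Fin n} (hL : IsLatin L)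
    (σ : Equiv.Perm (Fin n)) : IsLatin fun i j => σ (L i j) :=
  ⟨fun i => σ.bijective.comp (hL.1 i), fun j => σ.bijective.comp (hL.2 j)⟩

theorem IsLatin.colSign_perm_comp {n : ℕ} {L : Fin n → Fin n → Fin n} (hL : IsLatin L)
    (σ : Equiv.Perm (Fin n)) :
    colSign (fun i j => σ (L i j)) = (Equiv.Perm.sign σ : ℤ) ^ n * colSign L := by
  simp only [colSign, permOf_perm_comp σ (hL.2 _), Equiv.Perm.sign_mul, Units.val_mul,
    Finset.prod_mul_distrib, Finset.prod_const, Finset.card_univ, Fintype.card_fin]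

theorem card_firstCol_colSign_eq {n : ℕ} (hn : Odd n) (π : Equiv.Perm (Fin n)) (s : ℤ) :
    Nat.card {L : Fin n → Fin n → Fin n //
      IsLatin L ∧ (∀ i : Fin n, L i ⟨0, i.pos⟩ = π i) ∧ colSign L = s} =
    Nat.card {L : Fin n → Fin n → Fin n //
      IsLatin L ∧ (∀ i : Fin n, L i ⟨0, i.pos⟩ = (1 : Equiv.Perm (Fin n)) i) ∧
        colSign L = (Equiv.Perm.sign π : ℤ) * s} := by
  have key (σ : Equiv.Perm (Fin n)) {L : Fin n → Fin n → Fin n} (hL : IsLatin L) :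
      colSign (fun i j => σ (L i j)) = (Equiv.Perm.sign σ : ℤ) * colSign L := by
    rw [hL.colSign_perm_comp]
    rcases Int.units_eq_one_or (Equiv.Perm.sign σ) with h | h <;> simp [h, hn.neg_one_pow]
  refine Nat.card_congr
    { toFun := fun L => ⟨fun i j => π⁻¹ (L.1 i j), L.2.1.perm_comp _, ?_, ?_⟩
      invFun := fun L => ⟨fun i j => π (L.1 i j), L.2.1.perm_comp _, ?_, ?_⟩
      left_inv := fun L => Subtype.ext (by simp)
      right_inv := fun L => Subtype.ext (by simp) }
  · intro i
    simp [L.2.2.1 i]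
  · rw [key _ L.2.1, L.2.2.2, Equiv.Perm.sign_inv]
  · intro i
    simp [L.2.2.1 i]
  · rw [key _ L.2.1, L.2.2.2]
    rcases Int.units_eq_one_or (Equiv.Perm.sign π) with h | h <;> simp [h]

/-- For odd `n`, `ε(π)(L_n^CE(π) - L_n^CO(π)) = L_n^CE(id) - L_n^CO(id)`. -/
theorem sign_mul_colDiff_eq (n : ℕ) (hn : Odd n) (π : Equiv.Perm (Fin n)) :
    (Equiv.Perm.sign π : ℤ) * ((numColEven n π : ℤ) - numColOdd n π)
      = (numColEven n 1 : ℤ) - numColOdd n 1 := by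
  unfold numColEven numColOdd
  rw [card_firstCol_colSign_eq hn π 1, card_firstCol_colSign_eq hn π (-1)]
  rcases Int.units_eq_one_or (Equiv.Perm.sign π) with h | h <;> simp [h]
end
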